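/- arXiv:1109.3544 — 2 statements merged into one kernel-verified Lean document; each statement's English description precedes it below -/
import Mathlib

section
/- For every instance (I,J) of Variable-Sized Bin Covering with unit supply, OPT(I,J) ≤ (9/4)·NFD(I,J). -/
open scoped Classical

noncomputable section

namespace BinCov

/-- Profit of a solution `S` on the bin set `B`: a bin `i ∈ B` earns profit `p i`
if the total size of the items assigned to it is at least its demand `d i`. -/
def profit (d p s : ℕ → ℝ) (B : Finset ℕ) (S : ℕ → Finset ℕ) : ℝ :=
  ∑ i ∈ B, if d i ≤ ∑ j ∈ S i, s j then p i else 0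

/-- A solution assigns pairwise disjoint subsets of the item set `T` to the bins. -/
def IsSolution (T : Finset ℕ) (S : ℕ → Finset ℕ) : Prop :=
  (∀ i, S i ⊆ T) ∧ Pairwise fun i i' => Disjoint (S i) (S i')

/-- Optimal profit over all solutions on bins `B` and items `T`. -/
def OPT (d p s : ℕ → ℝ) (B T : Finset ℕ) : ℝ :=
  sSup (profit d p s B '' {S | IsSolution T S})

/-- Take a minimal prefix of `items` whose total size reaches `dem`;
returns this prefix together with the remaining items. -/
def takeFill (s : ℕ → ℝ) : ℝ → List ℕ → List ℕ × List ℕ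
  | _, [] => ([], [])
  | dem, j :: rest =>
    if dem ≤ s j then ([j], rest)
    else
      let q := takeFill s (dem - s j) rest
      (j :: q.1, q.2)

/-- Next Fit Decreasing on the list `bins` of bins and the list `items` of still
unassigned items (both by index, i.e. in non-increasing order of demand resp. size):
if the unassigned items cannot cover the current bin, it is left empty; otherwise a
minimal prefix of the unassigned items is assigned to it.  Returns, for each bin,
the set of items assigned to it. -/
def nfdAux (d s : ℕ → ℝ) : List ℕ → List ℕ → ℕ → Finset ℕ
  | [], _, _ => ∅
  | i :: bins, items, b =>
    if d i ≤ (items.map s).sum then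
      let q := takeFill s (d i) items
      if b = i then q.1.toFinset else nfdAux d s bins q.2 b
    else
      if b = i then ∅ else nfdAux d s bins items b

/-- The solution produced by NFD on bin set `B` and item set `T` (bins and items are
processed in increasing order of index; demands and sizes are non-increasing in the index). -/
def nfdSol (d s : ℕ → ℝ) (B T : Finset ℕ) : ℕ → Finset ℕ :=
  nfdAux d s (B.sort (· ≤ ·)) (T.sort (· ≤ ·))

/-- The total size `u i` that NFD assigns to bin `i`. -/
def nfdU (d s : ℕ → ℝ) (B T : Finset ℕ) (i : ℕ) : ℝ :=
  ∑ j ∈ nfdSol d s B T i, s j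

/-- The profit NFD earns (Variable-Sized Bin Covering: the profit of a bin is its demand). -/
def NFD (d s : ℕ → ℝ) (B T : Finset ℕ) : ℝ :=
  profit d d s B (nfdSol d s B T)

/-- A bin `istar` with `u istar > 0` in NFD's solution (bins `0,…,m-1`, items `T`) is
well-covered if for the smallest index `i' > istar` with `u i' = 0` (which must exist)
one has `u i ≤ 2 * d i` for all bins `i ≤ i'`. -/
def WellCovered (d s : ℕ → ℝ) (m : ℕ) (T : Finset ℕ) (istar : ℕ) : Prop :=
  istar < m ∧ 0 < nfdU d s (Finset.range m) T istar ∧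
    ∃ i', istar < i' ∧ i' < m ∧ nfdU d s (Finset.range m) T i' = 0 ∧
      (∀ i, istar < i → i < i' → nfdU d s (Finset.range m) T i ≠ 0) ∧
      ∀ i ≤ i', nfdU d s (Finset.range m) T i ≤ 2 * d i

/-- `istar` is the head of the instance: letting `i0` be the smallest index of a non-empty
bin of NFD's solution that is not well-covered, and `i1 ≥ i0` the smallest index with
`u (i1+1) = 0`, the head is the largest index `istar ≤ i1` with `u istar > 2 * d istar`. -/
def IsHead (d s : ℕ → ℝ) (m : ℕ) (T : Finset ℕ) (istar : ℕ) : Prop :=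
  ∃ i0 i1,
    i0 < m ∧ 0 < nfdU d s (Finset.range m) T i0 ∧ ¬ WellCovered d s m T i0 ∧
    (∀ i < i0, 0 < nfdU d s (Finset.range m) T i → WellCovered d s m T i) ∧
    i0 ≤ i1 ∧ nfdU d s (Finset.range m) T (i1 + 1) = 0 ∧
    (∀ i, i0 ≤ i → i < i1 → nfdU d s (Finset.range m) T (i + 1) ≠ 0) ∧
    istar ≤ i1 ∧ 2 * d istar < nfdU d s (Finset.range m) T istar ∧
    (∀ i ≤ i1, 2 * d i < nfdU d s (Finset.range m) T i → i ≤ istar)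

/-- The inner loop of `ALG*` on one bin: `dcap` is the bin's demand (items are admissible iff
their size is at most `dcap`), `space` is the part of the demand not yet covered, and `rem j`
is the still unassigned part of item `j` (items `0,…,n-1`, sizes non-increasing in the index).
While the bin is not covered and some admissible item is not fully assigned, the largest such
item (i.e. the one of smallest index) is taken and its remaining part is assigned to the bin,
splitting it so that the bin is exactly covered if it would overflow.
Returns the updated remainders together with the total amount assigned to the bin. -/
def fillBin (s : ℕ → ℝ) (n : ℕ) (dcap : ℝ) : ℕ → ℝ → (ℕ → ℝ) → (ℕ → ℝ) × ℝ
  | 0, _, rem => (rem, 0)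
  | fuel + 1, space, rem =>
    if h : ∃ j, j < n ∧ s j ≤ dcap ∧ 0 < rem j then
      let j := Nat.find h
      if rem j ≤ space then
        let q := fillBin s n dcap fuel (space - rem j) (Function.update rem j 0)
        (q.1, q.2 + rem j)
      else
        (Function.update rem j (rem j - space), space)
    else (rem, 0)

/-- The outer loop of `ALG*`: the bins are processed in the given order (non-increasing
efficiency); returns the total amount assigned to each bin. -/
def algStarFillAux (d s : ℕ → ℝ) (n : ℕ) : List ℕ → (ℕ → ℝ) → ℕ → ℝ
  | [], _, _ => 0
  | i :: bins, rem, b =>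
    let q := fillBin s n (d i) n (d i) rem
    if b = i then q.2 else algStarFillAux d s n bins q.1 b

/-- The total amount `ALG*` assigns to each bin, on the instance with bins `0,…,m-1`
(in non-increasing order of efficiency) and items `0,…,n-1` (in non-increasing order of size). -/
def algStarFill (m n : ℕ) (d s : ℕ → ℝ) : ℕ → ℝ :=
  algStarFillAux d s n (List.range m) fun j => if j < n then s j else 0

/-- The modified profit `p*` of the solution produced by `ALG*`. -/
def algStarPStar (m n : ℕ) (d p s : ℕ → ℝ) : ℝ :=
  ∑ i ∈ Finset.range m, p i * min (algStarFill m n d s i / d i) 1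

/-- The optimum of the linear program for the modified Bin Covering problem. -/
def LPOpt (m n : ℕ) (d p s : ℕ → ℝ) : ℝ :=
  sSup {v : ℝ | ∃ y : ℕ → ℝ, ∃ x : ℕ → ℕ → ℝ,
    (∀ i < m, y i ≤ (∑ j ∈ Finset.range n, x j i) / d i) ∧
    (∀ j < n, ∑ i ∈ Finset.range m, x j i ≤ s j) ∧
    (∀ i, 0 ≤ y i ∧ y i ≤ 1) ∧
    (∀ j i, 0 ≤ x j i) ∧
    (∀ j < n, ∀ i < m, d i < s j → x j i = 0) ∧
    v = ∑ i ∈ Finset.range m, p i * y i}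

/-- A solution of the modified Bin Covering problem, assigning item parts from the
finite set `P` (part `q ∈ P` belongs to item `itm q`) to the bins `0,…,m-1`;
a part may only be assigned to a bin to which its item is admissible. -/
def IsPartSolution (m : ℕ) (d s : ℕ → ℝ) (itm : ℕ → ℕ) (P : Finset ℕ) (S : ℕ → Finset ℕ) : Prop :=
  (∀ i, S i ⊆ P) ∧ (Pairwise fun i i' => Disjoint (S i) (S i')) ∧
  (∀ i < m, ∀ q ∈ S i, s (itm q) ≤ d i) ∧ (∀ i, m ≤ i → S i = ∅)

/-- The modified profit `p*` of a solution, where `psz q` is the size of part `q`. -/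
def pStarParts (m : ℕ) (d p psz : ℕ → ℝ) (S : ℕ → Finset ℕ) : ℝ :=
  ∑ i ∈ Finset.range m, p i * min ((∑ q ∈ S i, psz q) / d i) 1

/-- A solution of the modified Bin Covering problem is maximal if there are no two distinct
bins `i`, `i'` with `0 < s(S_i) < d_i`, `0 < s(S_i') < d_i'` and `e_i ≤ e_i'` such that
some item of `S_i` is admissible to bin `i'`. -/
def MaximalMod (m : ℕ) (d p s : ℕ → ℝ) (S : ℕ → Finset ℕ) : Prop :=
  ¬ ∃ i i', i < m ∧ i' < m ∧ i ≠ i' ∧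
      (0 < ∑ j ∈ S i, s j) ∧ (∑ j ∈ S i, s j) < d i ∧
      (0 < ∑ j ∈ S i', s j) ∧ (∑ j ∈ S i', s j) < d i' ∧
      p i / d i ≤ p i' / d i' ∧ ∃ j ∈ S i, s j ≤ d i'

/-- A solution induced by a matching in the bipartite graph on bins and items with an
edge `ij` whenever `s j > d i`: every bin receives at most one item, and any item
assigned to a bin covers it singularly. -/
def IsMatchingSol (m n : ℕ) (d s : ℕ → ℝ) (S : ℕ → Finset ℕ) : Prop :=
  IsSolution (Finset.range n) S ∧ (∀ i, (S i).card ≤ 1) ∧ ∀ i < m, ∀ j ∈ S i, d i < s j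

end BinCov

namespace BinCov

/-- The profit of NFD on lists of bins and items, by recursion on the list of bins. -/
def nfdVal (d s : ℕ → ℝ) : List ℕ → List ℕ → ℝ
  | [], _ => 0
  | i :: bins, items =>
    if d i ≤ (items.map s).sum then d i + nfdVal d s bins (takeFill s (d i) items).2
    else nfdVal d s bins items

/-- The block `z.2` of items is a minimal prefix covering the bin `z.1`. -/
def IsFill (d s : ℕ → ℝ) (z : ℕ × List ℕ) : Prop :=
  ∃ c x, z.2 = c ++ [x] ∧ (c.map s).sum < d z.1 ∧ d z.1 ≤ (c.map s).sum + s x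

lemma takeFill_spec (s : ℕ → ℝ) (T : List ℕ) (dem : ℝ) (h0 : 0 < dem)
    (h : dem ≤ (T.map s).sum) :
    ∃ c x, (takeFill s dem T).1 = c ++ [x] ∧ T = c ++ [x] ++ (takeFill s dem T).2 ∧
      (c.map s).sum < dem ∧ dem ≤ (c.map s).sum + s x := by
  induction T generalizing dem with
  | nil => simp at h; linarith
  | cons j T ih =>
    by_cases hj : dem ≤ s j
    · exact ⟨[], j, by simp [takeFill, hj], by simp [takeFill, hj], by simpa, by simpa⟩
    · simp only [List.map_cons, List.sum_cons] at h
      obtain ⟨c, x, h1, h2, h3, h4⟩ := ih (dem - s j) (by linarith) (by linarith)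
      refine ⟨j :: c, x, by simp [takeFill, hj, h1], ?_, ?_, ?_⟩
      · simp only [takeFill, hj, if_false, List.cons_append]
        rw [← h2]
      · simp only [List.map_cons, List.sum_cons]; linarith
      · simp only [List.map_cons, List.sum_cons]; linarith

lemma nfdVal_nonneg (d s : ℕ → ℝ) (L T : List ℕ) (hd : ∀ i ∈ L, 0 < d i) :
    0 ≤ nfdVal d s L T := by
  induction L generalizing T with
  | nil => simp [nfdVal]
  | cons i L ih =>
    have hL : ∀ i ∈ L, 0 < d i := fun k hk => hd k (by simp [hk])
    have hi := hd i (by simp)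
    simp only [nfdVal]
    split_ifs
    · have := ih (takeFill s (d i) T).2 hL; linarith
    · exact ih T hL

lemma le_nfdVal (d s : ℕ → ℝ) (L T : List ℕ) (hd : ∀ i ∈ L, 0 < d i)
    (hL : L.Pairwise fun a b => d b ≤ d a) (c : ℕ) (hc : c ∈ L) (hcT : d c ≤ (T.map s).sum) :
    d c ≤ nfdVal d s L T := by
  induction L with
  | nil => simp at hc
  | cons i L ih =>
    have hL' : ∀ i ∈ L, 0 < d i := fun k hk => hd k (by simp [hk])
    rw [List.pairwise_cons] at hL
    simp only [nfdVal]
    split_ifs with hi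
    · have := nfdVal_nonneg d s L (takeFill s (d i) T).2 hL'
      rcases List.mem_cons.1 hc with rfl | hc
      · linarith
      · linarith [hL.1 c hc]
    · rcases List.mem_cons.1 hc with rfl | hc
      · exact absurd hcT hi
      · exact ih hL' hL.2 hc

lemma nfdVal_le_profit (d s : ℕ → ℝ) (L T : List ℕ) (hd : ∀ i ∈ L, 0 < d i) (hL : L.Nodup)
    (hT : T.Nodup) :
    nfdVal d s L T ≤
      ∑ i ∈ L.toFinset, if d i ≤ ∑ j ∈ nfdAux d s L T i, s j then d i else 0 := by
  induction L generalizing T with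
  | nil => simp [nfdVal]
  | cons i L ih =>
    have hL' : ∀ i ∈ L, 0 < d i := fun k hk => hd k (by simp [hk])
    have hi := hd i (by simp)
    rw [List.nodup_cons] at hL
    have hne : ∀ b ∈ L.toFinset, b ≠ i := by
      rintro b hb rfl
      exact hL.1 (by simpa using hb)
    rw [List.toFinset_cons, Finset.sum_insert (by simpa using hL.1)]
    by_cases h : d i ≤ (T.map s).sum
    · obtain ⟨c, x, h1, h2, -, h4⟩ := takeFill_spec s T (d i) hi h
      have hT2 : (c ++ [x] ++ (takeFill s (d i) T).2).Nodup := h2 ▸ hT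
      rw [List.nodup_append] at hT2
      have e1 : ∑ j ∈ nfdAux d s (i :: L) T i, s j = (c.map s).sum + s x := by
        simp only [nfdAux, h, if_true, h1]
        rw [List.sum_toFinset _ hT2.1]
        simp
      rw [e1, if_pos h4]
      simp only [nfdVal, h, if_true]
      refine add_le_add le_rfl ((ih _ hL' hL.2 hT2.2.1).trans_eq ?_)
      refine Finset.sum_congr rfl fun b hb => ?_
      simp only [nfdAux, h, if_true, hne b hb, if_false]
    · have e1 : ∑ j ∈ nfdAux d s (i :: L) T i, s j = 0 := by
        simp only [nfdAux, h, if_false, if_true, Finset.sum_empty]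
      rw [e1, if_neg (by linarith), zero_add]
      simp only [nfdVal, h, if_false]
      refine (ih _ hL' hL.2 hT).trans_eq ?_
      refine Finset.sum_congr rfl fun b hb => ?_
      simp only [nfdAux, h, if_false, hne b hb]

/-- NFD either covers all bins, or its run can be cut at the first empty bin `b`. -/
lemma nfdVal_decomp (d s : ℕ → ℝ) (L T : List ℕ) (hd : ∀ i ∈ L, 0 < d i) :
    nfdVal d s L T = (L.map d).sum ∨
    ∃ (Z : List (ℕ × List ℕ)) (b : ℕ) (L' R : List ℕ),
      L = Z.map Prod.fst ++ b :: L' ∧ T = Z.flatMap Prod.snd ++ R ∧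
      (∀ z ∈ Z, IsFill d s z) ∧ (R.map s).sum < d b ∧
      nfdVal d s L T = (Z.map fun z => d z.1).sum + nfdVal d s L' R := by
  induction L generalizing T with
  | nil => left; simp [nfdVal]
  | cons i L ih =>
    have hL' : ∀ i ∈ L, 0 < d i := fun k hk => hd k (by simp [hk])
    by_cases h : d i ≤ (T.map s).sum
    · obtain ⟨c, x, h1, h2, h3, h4⟩ := takeFill_spec s T (d i) (hd i (by simp)) h
      rcases ih (takeFill s (d i) T).2 hL' with h5 | ⟨Z, b, L', R, h5, h6, h7, h8, h9⟩
      · left; simp [nfdVal, h, h5]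
      · right
        refine ⟨(i, c ++ [x]) :: Z, b, L', R, by simp [h5], ?_, ?_, h8, ?_⟩
        · rw [List.flatMap_cons, List.append_assoc, ← h6]; exact h2
        · intro z hz
          rcases List.mem_cons.1 hz with rfl | hz
          · exact ⟨c, x, rfl, h3, h4⟩
          · exact h7 z hz
        · simp only [nfdVal, h, if_true, h9, List.map_cons, List.sum_cons]; ring
    · right
      exact ⟨[], i, L, T, by simp, by simp, by simp, by linarith, by simp [nfdVal, h]⟩

lemma length_mul_le_sum (s : ℕ → ℝ) (c : List ℕ) (a : ℝ) (h : ∀ y ∈ c, a ≤ s y) :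
    (c.length : ℝ) * a ≤ (c.map s).sum := by
  induction c with
  | nil => simp
  | cons y c ih =>
    have := ih fun z hz => h z (by simp [hz])
    have := h y (by simp)
    simp only [List.length_cons, List.map_cons, List.sum_cons]
    push_cast
    linarith

lemma IsFill.one_le_length {d s : ℕ → ℝ} {z : ℕ × List ℕ} (h : IsFill d s z) :
    1 ≤ z.2.length := by
  obtain ⟨c, x, h, -⟩ := h
  simp [h]

lemma IsFill.overshoot {d s : ℕ → ℝ} {z : ℕ × List ℕ} (h : IsFill d s z)
    (hz : z.2.Pairwise fun a b => s b ≤ s a) :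
    ((z.2.length : ℝ) - 1) * ((z.2.map s).sum - d z.1) ≤ d z.1 := by
  obtain ⟨c, x, h, h1, h2⟩ := h
  rw [h, List.pairwise_append] at hz
  have h3 := length_mul_le_sum s c (s x) fun y hy => hz.2.2 y hy x (by simp)
  rw [h]
  simp only [List.length_append, List.length_cons, List.length_nil, List.map_append, List.map_cons,
    List.map_nil, List.sum_append, List.sum_cons, List.sum_nil]
  push_cast
  have h4 : (c.length : ℝ) * ((c.map s).sum + s x - d z.1) ≤ c.length * s x :=
    mul_le_mul_of_nonneg_left (by linarith) (by positivity)
  linarith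

lemma IsFill.length_mul_le {d s : ℕ → ℝ} {z : ℕ × List ℕ} (h : IsFill d s z) {a : ℝ}
    (hz : ∀ x ∈ z.2, a ≤ s x) :
    ((z.2.length : ℝ) - 1) * a ≤ d z.1 := by
  obtain ⟨c, x, h, h1, h2⟩ := h
  have h3 := length_mul_le_sum s c a fun y hy => hz y (by simp [h, hy])
  rw [h]
  simp only [List.length_append, List.length_cons, List.length_nil]
  push_cast
  linarith

lemma exists_split_last {α : Type*} (p : α → Prop) (Z : List α) :
    ∃ Z₁ Z₂, Z = Z₁ ++ Z₂ ∧ (∀ z ∈ Z₂, ¬ p z) ∧ (Z₁ = [] ∨ ∃ Z' z, Z₁ = Z' ++ [z] ∧ p z) := by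
  induction Z using List.reverseRecOn with
  | nil => exact ⟨[], [], by simp⟩
  | append_singleton Z a ih =>
    by_cases ha : p a
    · exact ⟨Z ++ [a], [], by simp, by simp, Or.inr ⟨Z, a, rfl, ha⟩⟩
    · obtain ⟨Z₁, Z₂, rfl, h2, h3⟩ := ih
      refine ⟨Z₁, Z₂ ++ [a], by simp, ?_, h3⟩
      intro z hz
      rcases List.mem_append.1 hz with hz | hz
      · exact h2 z hz
      · rw [List.mem_singleton.1 hz]; exact ha

lemma sum_sum_le (T : List ℕ) (hT : T.Nodup) (S : ℕ → Finset ℕ) (hS : IsSolution T.toFinset S)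
    (w : ℕ → ℝ) (hw : ∀ j ∈ T, 0 ≤ w j) (C : Finset ℕ) :
    ∑ b ∈ C, ∑ j ∈ S b, w j ≤ (T.map w).sum := by
  rw [← List.sum_toFinset _ hT, ← Finset.sum_biUnion fun a _ b _ hab => hS.2 hab]
  refine Finset.sum_le_sum_of_subset_of_nonneg ?_ fun j hj _ => hw j (by simpa using hj)
  exact Finset.biUnion_subset.2 fun b _ => hS.1 b

/-- Bins of `P` are counted fully; outside `P`, an item of `J₁` counts for at most `t`. -/
lemma sum_covered_le (d s : ℕ → ℝ) (J₁ J₂ : List ℕ) (hT : (J₁ ++ J₂).Nodup)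
    (hs : ∀ j ∈ J₁ ++ J₂, 0 < s j) (S : ℕ → Finset ℕ) (hS : IsSolution (J₁ ++ J₂).toFinset S)
    (C P : Finset ℕ) (hC : ∀ b ∈ C, d b ≤ ∑ j ∈ S b, s j) (hP : ∀ b ∈ P, 0 < d b)
    (t : ℝ) (ht : 0 ≤ t) (htC : ∀ j ∈ J₁, ∀ b ∈ C \ P, d b ≤ t) :
    ∑ b ∈ C, d b ≤ ∑ b ∈ P, d b + t * J₁.length + (J₂.map s).sum := by
  set w : ℕ → ℝ := fun j => if j ∈ J₁ then t else s j with hw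
  have hw0 : ∀ j ∈ J₁ ++ J₂, 0 ≤ w j := by
    intro j hj
    simp only [hw]
    split_ifs
    · exact ht
    · exact (hs j hj).le
  have h1 := sum_sum_le _ hT S hS w hw0 (C \ P)
  have h2 : ((J₁ ++ J₂).map w).sum = t * J₁.length + (J₂.map s).sum := by
    rw [List.nodup_append] at hT
    rw [List.map_append, List.sum_append]
    congr 1
    · rw [List.map_congr_left (g := fun _ => t) fun j hj => by simp [hw, hj]]
      simp [mul_comm]
    · rw [List.map_congr_left (g := s)]
      intro j hj
      have : j ∉ J₁ := fun hj' => hT.2.2 j hj' j hj rfl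
      simp [hw, this]
  have h3 : ∑ b ∈ C \ P, d b ≤ ∑ b ∈ C \ P, ∑ j ∈ S b, w j := by
    refine Finset.sum_le_sum fun b hb => ?_
    have hSw : ∀ j ∈ S b, 0 ≤ w j := fun j hj => hw0 j (by simpa using hS.1 b hj)
    by_cases h : ∃ j ∈ S b, j ∈ J₁
    · obtain ⟨j, hj, hj'⟩ := h
      have h4 := Finset.single_le_sum hSw hj
      have h5 : w j = t := by simp [hw, hj']
      linarith [htC j hj' b hb]
    · push Not at h
      refine (hC b (Finset.mem_sdiff.1 hb).1).trans_eq (Finset.sum_congr rfl fun j hj => ?_)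
      simp [hw, h j hj]
  have h4 : ∑ b ∈ C ∩ P, d b ≤ ∑ b ∈ P, d b :=
    Finset.sum_le_sum_of_subset_of_nonneg Finset.inter_subset_right fun b hb _ => (hP b hb).le
  have h5 := Finset.sum_inter_add_sum_sdiff C P d
  linarith

lemma card_meeting_le (J R : List ℕ) (hT : (J ++ R).Nodup) (S : ℕ → Finset ℕ)
    (hS : IsSolution (J ++ R).toFinset S) (B : Finset ℕ) (hB : ∀ b ∈ B, ∃ j ∈ S b, j ∈ J) :
    B.card ≤ J.length := by
  have h := sum_sum_le _ hT S hS (fun j => if j ∈ J then 1 else 0)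
    (fun j _ => by positivity) B
  have h1 : ((J ++ R).map fun j => if j ∈ J then (1 : ℝ) else 0).sum = J.length := by
    rw [List.nodup_append] at hT
    rw [List.map_append, List.sum_append,
      List.map_congr_left (l := J) (g := fun _ => (1 : ℝ)) fun j hj => by simp [hj],
      List.map_congr_left (l := R) (g := fun _ => (0 : ℝ))]
    · simp
    · intro j hj
      have : j ∉ J := fun hj' => hT.2.2 j hj' j hj rfl
      simp [this]
  have h2 : (B.card : ℝ) ≤ ∑ b ∈ B, ∑ j ∈ S b, if j ∈ J then (1 : ℝ) else 0 := by
    rw [Finset.card_eq_sum_ones]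
    push_cast
    refine Finset.sum_le_sum fun b hb => ?_
    obtain ⟨j, hj, hj'⟩ := hB b hb
    have := Finset.single_le_sum (f := fun j => if j ∈ J then (1 : ℝ) else 0)
      (fun j _ => by positivity) hj
    simpa [hj'] using this
  rw [h1] at h
  exact_mod_cast h2.trans h

/-- At most twice as many bins as in the prefix `P` have at most twice the total demand. -/
lemma sum_le_two_mul (d : ℕ → ℝ) (P : List ℕ) (hP : P.Nodup) (δ : ℝ) (hδ : 0 < δ)
    (hPδ : ∀ i ∈ P, δ ≤ d i) (B : Finset ℕ) (hB : ∀ b ∈ B, b ∉ P → d b ≤ δ)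
    (hc : B.card ≤ 2 * P.length) :
    ∑ b ∈ B, d b ≤ 2 * (P.map d).sum := by
  have h1 : ∑ b ∈ B, (d b - δ) ≤ ∑ b ∈ P.toFinset, (d b - δ) := by
    rw [← Finset.sum_inter_add_sum_sdiff B P.toFinset]
    have h2 : ∑ b ∈ B ∩ P.toFinset, (d b - δ) ≤ ∑ b ∈ P.toFinset, (d b - δ) :=
      Finset.sum_le_sum_of_subset_of_nonneg Finset.inter_subset_right
        fun b hb _ => by linarith [hPδ b (by simpa using hb)]
    have h3 : ∑ b ∈ B \ P.toFinset, (d b - δ) ≤ 0 := by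
      refine Finset.sum_nonpos fun b hb => ?_
      simp only [Finset.mem_sdiff, List.mem_toFinset] at hb
      linarith [hB b hb.1 hb.2]
    linarith
  rw [Finset.sum_sub_distrib, Finset.sum_sub_distrib, List.sum_toFinset _ hP,
    Finset.sum_const, Finset.sum_const, List.toFinset_card_of_nodup hP, nsmul_eq_mul,
    nsmul_eq_mul] at h1
  have h2 := length_mul_le_sum d P δ hPδ
  have h3 : (B.card : ℝ) * δ ≤ (2 * P.length) * δ :=
    mul_le_mul_of_nonneg_right (by exact_mod_cast hc) hδ.le
  nlinarith

lemma length_flatMap_mul_le (d s : ℕ → ℝ) (Z : List (ℕ × List ℕ)) (t : ℝ) (ht : 0 ≤ t)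
    (hZ : ∀ z ∈ Z, IsFill d s z) (htZ : ∀ z ∈ Z, t ≤ d z.1)
    (hs : ∀ z ∈ Z, ∀ x ∈ z.2, 2 * t ≤ s x) :
    t * (Z.flatMap Prod.snd).length ≤ (Z.map fun z => d z.1).sum := by
  induction Z with
  | nil => simp
  | cons z Z ih =>
    have h1 := ih (fun y hy => hZ y (by simp [hy])) (fun y hy => htZ y (by simp [hy]))
      (fun y hy => hs y (by simp [hy]))
    have h2 := hZ z (by simp)
    have h3 := h2.length_mul_le (hs z (by simp))
    have h4 := htZ z (by simp)
    simp only [List.flatMap_cons, List.length_append, List.map_cons, List.sum_cons]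
    push_cast
    have h5 : t * z.2.length ≤ d z.1 := by
      rcases h2.one_le_length.eq_or_lt with h | h
      · rw [← h]; push_cast; linarith
      · have : (2 : ℝ) ≤ z.2.length := by exact_mod_cast h
        nlinarith
    linarith

/-- A bin covered more than twice receives one item, so all earlier items are large. -/
lemma two_mul_le_of_lt (d s : ℕ → ℝ) (Z : List (ℕ × List ℕ)) (z : ℕ × List ℕ)
    (hz : IsFill d s z) (hd : 0 < d z.1)
    (hs : ((Z ++ [z]).flatMap Prod.snd).Pairwise fun a b => s b ≤ s a)
    (h : 2 * d z.1 < (z.2.map s).sum) :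
    ∀ j ∈ (Z ++ [z]).flatMap Prod.snd, 2 * d z.1 ≤ s j := by
  simp only [List.flatMap_append, List.flatMap_cons, List.flatMap_nil, List.append_nil] at hs ⊢
  rw [List.pairwise_append] at hs
  have h1 := hz.overshoot hs.2.1
  have h2 : z.2.length = 1 := by
    have h3 := hz.one_le_length
    by_contra h4
    have h5 : (2 : ℝ) ≤ z.2.length := by exact_mod_cast (show 2 ≤ z.2.length by omega)
    nlinarith
  obtain ⟨x, hx⟩ := List.length_eq_one_iff.1 h2
  rw [hx] at h
  simp only [List.map_cons, List.map_nil, List.sum_cons, List.sum_nil, add_zero] at h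
  intro j hj
  rcases List.mem_append.1 hj with hj | hj
  · have := hs.2.2 j hj x (by simp [hx])
    linarith
  · rw [hx, List.mem_singleton] at hj
    rw [hj]; exact h.le

lemma sum_map_le_sub {α : Type*} (l : List α) (f g : α → ℝ) (h : ∀ x ∈ l, f x ≤ g x) (x : α)
    (hx : x ∈ l) (e : ℝ) (he : f x ≤ g x - e) : (l.map f).sum ≤ (l.map g).sum - e := by
  induction l with
  | nil => simp at hx
  | cons y l ih =>
    have hl : ∀ x ∈ l, f x ≤ g x := fun x hx => h x (by simp [hx])
    simp only [List.map_cons, List.sum_cons]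
    rcases List.mem_cons.1 hx with rfl | hx
    · have := List.sum_le_sum hl
      linarith
    · linarith [ih hl hx, h y (by simp)]

lemma sum_map_flatMap (s : ℕ → ℝ) (Z : List (ℕ × List ℕ)) :
    ((Z.flatMap Prod.snd).map s).sum = (Z.map fun z => (z.2.map s).sum).sum := by
  induction Z with
  | nil => simp
  | cons z Z ih => simp [ih]

/-- The case where NFD covers one bin, of demand `D` and with at least three items,
before it first leaves a bin empty. -/
lemma sum_le_of_single (d : ℕ → ℝ) (B C : Finset ℕ) (D U r X k : ℝ) (hBC : B ⊆ C)
    (hC : ∀ b ∈ C, 0 < d b) (hU : ∑ b ∈ C, d b ≤ U + r) (hk : 3 ≤ k)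
    (hkU : (k - 1) * (U - D) ≤ D) (hDU : D ≤ U) (hr : r < D) (hX0 : 0 ≤ X)
    (hX : ∀ b ∈ B, d b ≤ r → d b ≤ X)
    (hBD : ∀ b ∈ B, d b ≤ D) (hB : (B.card : ℝ) ≤ k)
    (hsplit : ∑ b ∈ C, d b ≤ ∑ b ∈ B, d b + 9 / 4 * X) :
    ∑ b ∈ C, d b ≤ 9 / 4 * (D + X) := by
  have hU2 : 2 * (U - D) ≤ D := by nlinarith
  by_cases h5 : 5 ≤ k
  · have : 4 * (U - D) ≤ D := by nlinarith
    linarith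
  by_cases hr2 : r ≤ 3 / 4 * D
  · linarith
  by_cases hc : ∃ b ∈ B, D / 9 ≤ d b ∧ d b ≤ r
  · obtain ⟨b, hb, h1, h2⟩ := hc
    linarith [hX b hb h2]
  push Not at h5 hr2 hc
  have h0 : ∑ b ∈ B, d b ≤ ∑ b ∈ C, d b :=
    Finset.sum_le_sum_of_subset_of_nonneg hBC fun b hb _ => (hC b hb).le
  have hlarge : (B.filter fun b => r < d b).card ≤ 2 := by
    by_contra h3
    have h3 : (3 : ℝ) ≤ (B.filter fun b => r < d b).card := by
      exact_mod_cast (show 3 ≤ (B.filter fun b => r < d b).card by omega)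
    have h4 := Finset.card_nsmul_le_sum (B.filter fun b => r < d b) d r
      fun b hb => (Finset.mem_filter.1 hb).2.le
    rw [nsmul_eq_mul] at h4
    have h6 : ∑ b ∈ B.filter (fun b => r < d b), d b ≤ ∑ b ∈ B, d b :=
      Finset.sum_le_sum_of_subset_of_nonneg (Finset.filter_subset _ _)
        fun b hb _ => (hC b (hBC hb)).le
    nlinarith
  have hcard := Finset.card_filter_add_card_filter_not (s := B) fun b => r < d b
  have hsum := Finset.sum_filter_add_sum_filter_not B (fun b => r < d b) d
  have h6 := Finset.sum_le_card_nsmul (B.filter fun b => r < d b) d D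
    fun b hb => hBD b (Finset.mem_filter.1 hb).1
  have h7 := Finset.sum_le_card_nsmul (B.filter fun b => ¬ r < d b) d (D / 9) fun b hb => by
    obtain ⟨hb1, hb2⟩ := Finset.mem_filter.1 hb
    by_contra h8
    exact hb2 (hc b hb1 (by linarith))
  rw [nsmul_eq_mul] at h6 h7
  have hB4 : B.card ≤ 4 := by
    have : (B.card : ℝ) < 5 := by linarith
    have : B.card < 5 := by exact_mod_cast this
    omega
  have h8 : ((B.filter fun b => r < d b).card : ℝ) ≤ 2 := by exact_mod_cast hlarge
  have h9 : ((B.filter fun b => r < d b).card : ℝ) + (B.filter fun b => ¬ r < d b).card ≤ 4 := by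
    exact_mod_cast hcard.trans_le hB4
  nlinarith

/-- Bound on covered demand before accounting for bins left empty by NFD: there is a cut of the
run such that bins before the cut have large demand whenever they get three or more items, and
bins after the cut are covered at most twice. -/
lemma exists_cut (d s : ℕ → ℝ) (Z : List (ℕ × List ℕ)) (R : List ℕ) (C : Finset ℕ) (δ : ℝ)
    (S : ℕ → Finset ℕ) (hδ : 0 < δ)
    (hZ : ∀ z ∈ Z, IsFill d s z) (hZδ : ∀ z ∈ Z, δ ≤ d z.1)
    (hnd : (Z.map Prod.fst).Nodup) (hmono : Z.Pairwise fun a b => d b.1 ≤ d a.1)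
    (hCδ : ∀ b ∈ C, b ∉ Z.map Prod.fst → d b ≤ δ)
    (hT : (Z.flatMap Prod.snd ++ R).Nodup) (hs : ∀ j ∈ Z.flatMap Prod.snd ++ R, 0 < s j)
    (hsm : (Z.flatMap Prod.snd).Pairwise fun a b => s b ≤ s a)
    (hS : IsSolution (Z.flatMap Prod.snd ++ R).toFinset S)
    (hC : ∀ b ∈ C, d b ≤ ∑ j ∈ S b, s j) :
    ∃ Z₁ Z₂, Z = Z₁ ++ Z₂ ∧ (∀ z ∈ Z₂, (z.2.map s).sum ≤ 2 * d z.1) ∧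
      (∀ z ∈ Z₁, 3 ≤ z.2.length → 4 * δ ≤ d z.1) ∧
      ∑ b ∈ C, d b ≤ 2 * (Z₁.map fun z => d z.1).sum +
        (Z₂.map fun z => (z.2.map s).sum).sum + (R.map s).sum := by
  obtain ⟨Z₁, Z₂, rfl, h2, h3⟩ :=
    exists_split_last (fun z : ℕ × List ℕ => 2 * d z.1 < (z.2.map s).sum) Z
  refine ⟨Z₁, Z₂, rfl, fun z hz => not_lt.1 (h2 z hz), ?_⟩
  have hJ : (Z₁ ++ Z₂).flatMap Prod.snd ++ R =
      Z₁.flatMap Prod.snd ++ (Z₂.flatMap Prod.snd ++ R) := by simp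
  rw [hJ] at hT hs hS
  have key := sum_covered_le d s _ _ hT hs S hS C (Z₁.map Prod.fst).toFinset hC
  rw [List.map_append, List.sum_append, sum_map_flatMap] at key
  rcases h3 with rfl | ⟨Z', z, rfl, hz⟩
  · refine ⟨by simp, ?_⟩
    have := key (by simp) 0 le_rfl (by simp)
    simp only [List.map_nil, List.toFinset_nil, Finset.sum_empty, List.sum_nil] at this ⊢
    linarith
  have hd1 : ∀ y ∈ Z' ++ [z], δ ≤ d y.1 := fun y hy => hZδ y (List.mem_append_left _ hy)
  have hfill : ∀ y ∈ Z' ++ [z], IsFill d s y := fun y hy => hZ y (List.mem_append_left _ hy)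
  have hzpos : 0 < d z.1 := hδ.trans_le (hd1 z (by simp))
  have hzd : ∀ y ∈ Z' ++ [z], d z.1 ≤ d y.1 := by
    intro y hy
    have h4 := (List.pairwise_append.1 (List.pairwise_append.1 hmono).1).2.2
    rcases List.mem_append.1 hy with hy | hy
    · exact h4 y hy z (by simp)
    · rw [List.mem_singleton.1 hy]
  have hzd2 : ∀ y ∈ Z₂, d y.1 ≤ d z.1 := fun y hy =>
    (List.pairwise_append.1 hmono).2.2 z (by simp) y hy
  rw [List.flatMap_append] at hsm
  have hbig := two_mul_le_of_lt d s Z' z (hfill z (by simp)) hzpos (List.pairwise_append.1 hsm).1 hz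
  have hbig' : ∀ y ∈ Z' ++ [z], ∀ x ∈ y.2, 2 * d z.1 ≤ s x := fun y hy x hx =>
    hbig x (List.mem_flatMap.2 ⟨y, hy, hx⟩)
  refine ⟨fun y hy h4 => ?_, ?_⟩
  · have h5 := (hfill y hy).length_mul_le (hbig' y hy)
    have h6 : (3 : ℝ) ≤ y.2.length := by exact_mod_cast h4
    have h7 := hd1 z (by simp)
    nlinarith
  · have h4 := key (fun b hb => ?_) (d z.1) hzpos.le ?_
    · have h5 := length_flatMap_mul_le d s _ _ hzpos.le hfill hzd hbig'
      have hnd1 : ((Z' ++ [z]).map Prod.fst).Nodup := by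
        rw [List.map_append] at hnd
        exact (List.nodup_append.1 hnd).1
      rw [List.sum_toFinset _ hnd1, List.map_map] at h4
      have h6 : d ∘ Prod.fst = fun z : ℕ × List ℕ => d z.1 := rfl
      rw [h6] at h4
      linarith
    · obtain ⟨y, hy, rfl⟩ := List.mem_map.1 (List.mem_toFinset.1 hb)
      exact hδ.trans_le (hd1 y hy)
    · intro j _ b hb
      obtain ⟨hb1, hb2⟩ := Finset.mem_sdiff.1 hb
      rw [List.mem_toFinset] at hb2
      by_cases hb3 : b ∈ (Z' ++ [z] ++ Z₂).map Prod.fst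
      · rw [List.map_append, List.mem_append] at hb3
        obtain ⟨y, hy, rfl⟩ := List.mem_map.1 (hb3.resolve_left hb2)
        exact hzd2 y hy
      · exact (hCδ b hb1 hb3).trans (hd1 z (by simp))

theorem sum_le_nfdVal (d s : ℕ → ℝ) (N : ℕ) (L T : List ℕ) (hN : L.length ≤ N)
    (hd : ∀ i ∈ L, 0 < d i) (hL : L.Nodup) (hLm : L.Pairwise fun a b => d b ≤ d a)
    (hs : ∀ j ∈ T, 0 < s j) (hT : T.Nodup) (hTm : T.Pairwise fun a b => s b ≤ s a)
    (S : ℕ → Finset ℕ) (hS : IsSolution T.toFinset S) (C : Finset ℕ) (hCL : C ⊆ L.toFinset)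
    (hC : ∀ b ∈ C, d b ≤ ∑ j ∈ S b, s j) :
    ∑ b ∈ C, d b ≤ 9 / 4 * nfdVal d s L T := by
  induction N generalizing L T S C with
  | zero =>
    obtain rfl : L = [] := List.length_eq_zero_iff.1 (by omega)
    obtain rfl : C = ∅ := by simpa using hCL
    simp [nfdVal]
  | succ N ih =>
  rcases nfdVal_decomp d s L T hd with h | ⟨Z, b, L', R, rfl, rfl, hZ, hR, hval⟩
  · rw [h, ← List.sum_toFinset _ hL]
    have h1 : ∑ b ∈ C, d b ≤ ∑ b ∈ L.toFinset, d b :=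
      Finset.sum_le_sum_of_subset_of_nonneg hCL fun b hb _ => (hd b (by simpa using hb)).le
    have h2 : 0 ≤ ∑ b ∈ L.toFinset, d b :=
      Finset.sum_nonneg fun b hb => (hd b (by simpa using hb)).le
    linarith
  rw [hval]
  have hδ : 0 < d b := hd b (by simp)
  have hLm' := List.pairwise_append.1 hLm
  have hLc := List.pairwise_cons.1 hLm'.2.1
  have hLn := List.nodup_append.1 hL
  have hTn := List.nodup_append.1 hT
  have hTm' := List.pairwise_append.1 hTm
  have hZδ : ∀ i ∈ Z.map Prod.fst, d b ≤ d i := fun i hi => hLm'.2.2 i hi b (by simp)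
  have hZδ' : ∀ z ∈ Z, d b ≤ d z.1 := fun z hz => hZδ z.1 (List.mem_map.2 ⟨z, hz, rfl⟩)
  have hdL' : ∀ i ∈ L', 0 < d i := fun i hi => hd i (by simp [hi])
  have hR0 : 0 ≤ (R.map s).sum :=
    List.sum_nonneg fun x hx => by
      obtain ⟨j, hj, rfl⟩ := List.mem_map.1 hx
      exact (hs j (by simp [hj])).le
  have hCδ : ∀ c ∈ C, c ∉ Z.map Prod.fst → d c ≤ d b := by
    intro c hc hcZ
    have h1 := hCL hc
    rw [List.mem_toFinset, List.mem_append] at h1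
    rcases List.mem_cons.1 (h1.resolve_left hcZ) with rfl | h1
    · exact le_rfl
    · exact hLc.1 c h1
  have hsmall : ∀ c ∈ C, d c ≤ (R.map s).sum → c ∈ L' := by
    intro c hc hcR
    have h1 := hCL hc
    rw [List.mem_toFinset, List.mem_append] at h1
    rcases h1 with h1 | h1
    · linarith [hZδ c h1]
    · rcases List.mem_cons.1 h1 with rfl | h1
      · linarith
      · exact h1
  have hX0 := nfdVal_nonneg d s L' R hdL'
  set X := nfdVal d s L' R with hX
  set B := C.filter fun c => ∃ j ∈ S c, j ∈ Z.flatMap Prod.snd with hB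
  have hBcard : B.card ≤ (Z.flatMap Prod.snd).length :=
    card_meeting_le _ _ hT S hS B fun c hc => (Finset.mem_filter.1 hc).2
  have hsplit : ∑ c ∈ C, d c ≤ ∑ c ∈ B, d c + 9 / 4 * X := by
    rw [← Finset.sum_filter_add_sum_filter_not C fun c => ∃ j ∈ S c, j ∈ Z.flatMap Prod.snd]
    refine add_le_add le_rfl ?_
    have hSR : ∀ c ∈ C.filter (fun c => ¬ ∃ j ∈ S c, j ∈ Z.flatMap Prod.snd),
        S c ⊆ R.toFinset := by
      intro c hc j hj
      have h1 := hS.1 c hj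
      rw [List.mem_toFinset, List.mem_append] at h1
      rw [List.mem_toFinset]
      exact h1.resolve_left fun h2 => (Finset.mem_filter.1 hc).2 ⟨j, hj, h2⟩
    refine ih L' R ?_ hdL' (List.nodup_cons.1 hLn.2.1).2 hLc.2 (fun j hj => hs j (by simp [hj]))
      hTn.2.1 hTm'.2.1 (fun c => if S c ⊆ R.toFinset then S c else ∅) ⟨?_, ?_⟩ _ ?_ ?_
    · simp only [List.length_append, List.length_cons] at hN
      omega
    · intro c
      dsimp only
      split_ifs with h1
      · exact h1
      · simp
    · intro c c' hcc
      dsimp only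
      split_ifs <;> first | exact hS.2 hcc | simp
    · intro c hc
      rw [List.mem_toFinset]
      have hcC := (Finset.mem_filter.1 hc).1
      refine hsmall c hcC ((hC c hcC).trans ?_)
      rw [← List.sum_toFinset _ hTn.2.1]
      exact Finset.sum_le_sum_of_subset_of_nonneg (hSR c hc)
        fun j hj _ => (hs j (List.mem_append_right _ (by simpa using hj))).le
    · intro c hc
      rw [if_pos (hSR c hc)]
      exact hC c (Finset.mem_filter.1 hc).1
  by_cases hk : ∀ z ∈ Z, z.2.length ≤ 2
  · have h1 : (Z.flatMap Prod.snd).length ≤ 2 * (Z.map Prod.fst).length := by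
      clear * - hk
      induction Z with
      | nil => simp
      | cons z Z ih =>
        have := ih fun y hy => hk y (by simp [hy])
        have := hk z (by simp)
        simp only [List.flatMap_cons, List.length_append, List.map_cons, List.length_cons]
        omega
    have h2 := sum_le_two_mul d _ hLn.1 (d b) hδ hZδ B
      (fun c hc => hCδ c (Finset.mem_filter.1 hc).1) (hBcard.trans h1)
    have h3 : d ∘ Prod.fst = fun z : ℕ × List ℕ => d z.1 := rfl
    rw [List.map_map, h3] at h2
    have h4 : 0 ≤ (Z.map fun z => d z.1).sum :=
      List.sum_nonneg fun x hx => by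
        obtain ⟨z, hz, rfl⟩ := List.mem_map.1 hx
        exact hδ.le.trans (hZδ' z hz)
    linarith
  push Not at hk
  obtain ⟨z, hz, hz3⟩ := hk
  have hzD := sum_map_le_sub Z (fun _ => 0) (fun z => d z.1)
    (fun y hy => hδ.le.trans (hZδ' y hy)) z hz (d z.1) (by linarith)
  simp only [List.map_const', List.sum_replicate, smul_zero] at hzD
  have hz3' : (3 : ℝ) ≤ z.2.length := by exact_mod_cast hz3
  have hzs : z.2.Pairwise fun a b => s b ≤ s a :=
    (List.pairwise_flatMap.1 hTm'.1).1 z hz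
  have hover := (hZ z hz).overshoot hzs
  have hzδ := hZδ' z hz
  obtain ⟨Z₁, Z₂, hZZ, h2, h3, h4⟩ := exists_cut d s Z R C (d b) S hδ hZ hZδ' hLn.1
    (List.pairwise_map.1 hLm'.1) hCδ hT hs hTm'.1 hS hC
  have hD : (Z.map fun z => d z.1).sum =
      (Z₁.map fun z => d z.1).sum + (Z₂.map fun z => d z.1).sum := by
    rw [hZZ, List.map_append, List.sum_append]
  rw [hZZ, List.mem_append] at hz
  rcases hz with hz | hz
  · have h5 := h3 z hz hz3
    have h6 := List.sum_le_sum h2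
    rw [List.sum_map_mul_left] at h6
    linarith
  · have hover2 : (z.2.map s).sum ≤ 2 * d z.1 - d z.1 / 2 := by nlinarith
    have h6 := sum_map_le_sub Z₂ _ _ h2 z hz (d z.1 / 2) hover2
    rw [List.sum_map_mul_left] at h6
    by_cases hlen : 2 ≤ Z.length
    · have h7 := length_mul_le_sum d (Z.map Prod.fst) (d b) hZδ
      have h8 : d ∘ Prod.fst = fun z : ℕ × List ℕ => d z.1 := rfl
      rw [List.map_map, h8, List.length_map] at h7
      have h9 : (2 : ℝ) ≤ Z.length := by exact_mod_cast hlen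
      nlinarith
    · have hz' : z ∈ Z := hZZ ▸ List.mem_append_right _ hz
      have hlen1 : Z.length = 1 := by
        have := List.length_pos_of_mem hz'
        omega
      obtain ⟨y, rfl⟩ := List.length_eq_one_iff.1 hlen1
      obtain rfl := List.mem_singleton.1 hz'
      simp only [List.map_cons, List.map_nil, List.sum_cons, List.sum_nil, add_zero]
      have hU := sum_covered_le d s [] ([z].flatMap Prod.snd ++ R) hT hs S hS C ∅ hC (by simp) 0
        le_rfl (by simp)
      rw [List.map_append, List.sum_append, sum_map_flatMap] at hU
      simp only [Finset.sum_empty, List.length_nil, Nat.cast_zero, mul_zero, zero_add,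
        List.map_cons, List.map_nil, List.sum_cons, List.sum_nil, add_zero] at hU
      have hBC : B ⊆ C := Finset.filter_subset _ _
      refine sum_le_of_single d B C (d z.1) _ _ X z.2.length hBC ?_ hU hz3' hover ?_
        (by linarith) hX0 ?_ ?_ ?_ hsplit
      · exact fun c hc => hd c (by simpa using hCL hc)
      · obtain ⟨c, x, e1, -, e2⟩ := hZ z (by simp)
        rw [e1]
        simpa using e2
      · exact fun c hc hcR => le_nfdVal d s L' R hdL' hLc.2 c (hsmall c (hBC hc) hcR) hcR
      · intro c hc
        by_cases hcz : c ∈ [z].map Prod.fst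
        · simp only [List.map_cons, List.map_nil, List.mem_singleton] at hcz
          rw [hcz]
        · exact (hCδ c (hBC hc) hcz).trans hzδ
      · simp only [List.flatMap_cons, List.flatMap_nil, List.append_nil] at hBcard
        exact_mod_cast hBcard

/- STATEMENT 6 -/
theorem stmt6 (m n : ℕ) (d s : ℕ → ℝ)
    (hd : ∀ i < m, 0 < d i) (hdm : ∀ i i', i ≤ i' → i' < m → d i' ≤ d i)
    (hs : ∀ j < n, 0 < s j) (hsm : ∀ j j', j ≤ j' → j' < n → s j' ≤ s j) :
    OPT d d s (Finset.range m) (Finset.range n) ≤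
      9 / 4 * NFD d s (Finset.range m) (Finset.range n) := by
  have hL : (List.range m).Nodup := List.nodup_range
  have hT : (List.range n).Nodup := List.nodup_range
  have hdL : ∀ i ∈ List.range m, 0 < d i := fun i hi => hd i (List.mem_range.1 hi)
  have hsT : ∀ j ∈ List.range n, 0 < s j := fun j hj => hs j (List.mem_range.1 hj)
  have hLm : (List.range m).Pairwise fun a b => d b ≤ d a :=
    List.pairwise_lt_range.imp_of_mem fun _ hb hab => hdm _ _ hab.le (List.mem_range.1 hb)
  have hTm : (List.range n).Pairwise fun a b => s b ≤ s a :=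
    List.pairwise_lt_range.imp_of_mem fun _ hb hab => hsm _ _ hab.le (List.mem_range.1 hb)
  have hNFD : nfdVal d s (List.range m) (List.range n) ≤
      NFD d s (Finset.range m) (Finset.range n) := by
    have h := nfdVal_le_profit d s (List.range m) (List.range n) hdL hL hT
    rw [List.toFinset_range] at h
    simpa only [NFD, profit, nfdSol, Finset.sort_range] using h
  refine csSup_le ⟨_, fun _ => ∅, ⟨fun _ => by simp, fun _ _ _ => by simp⟩, rfl⟩ ?_
  rintro _ ⟨S, hS, rfl⟩
  have h := sum_le_nfdVal d s m (List.range m) (List.range n) (by simp) hdL hL hLm hsT hT hTm S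
    (by rw [List.toFinset_range]; exact hS)
    ((Finset.range m).filter fun i => d i ≤ ∑ j ∈ S i, s j)
    (by rw [List.toFinset_range]; exact Finset.filter_subset _ _)
    (fun b hb => (Finset.mem_filter.1 hb).2)
  rw [Finset.sum_filter] at h
  exact h.trans (by linarith)

end BinCov
end
end

section
/- Consider NFD's solution to an instance (I,J) of Variable-Sized Bin Covering with unit supply, and let i* be the smallest index of a bin with u(i*) > 0 and u(i*+1) = 0. Let i_1,…,i_k ∈ {1,…,i*} be the indices with u(i_j) ≥ 2·d_{i_j} for j = 1,…,k, and let j_1,…,j_k be the (single) items NFD assigns to these bins. Set I' = I ∖ {i_1,…,i_k} and J' = J ∖ {j_1,…,j_k}, and assume NFD(I',J') > 0. Then OPT(I,J)·NFD(I',J') ≤ OPT(I',J')·NFD(I,J), i.e., OPT(I,J)/NFD(I,J) ≤ OPT(I',J')/NFD(I',J'). -/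
open scoped Classical

noncomputable section

namespace BinCov

section TakeFill

variable {s : ℕ → ℝ}

lemma takeFill_append (x : ℝ) (K : List ℕ) :
    (takeFill s x K).1 ++ (takeFill s x K).2 = K := by
  induction K generalizing x with
  | nil => simp [takeFill]
  | cons j K ih =>
    by_cases h : x ≤ s j
    · simp [takeFill, h]
    · simp [takeFill, h, ih]

lemma le_sum_takeFill (x : ℝ) (K : List ℕ) (h : x ≤ (K.map s).sum) :
    x ≤ ((takeFill s x K).1.map s).sum := by
  induction K generalizing x with
  | nil => simpa [takeFill] using h
  | cons j K ih =>
    by_cases hj : x ≤ s j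
    · simp [takeFill, hj]
    · have := ih (x - s j) (by simp at h; linarith)
      simp [takeFill, hj]
      linarith

lemma takeFill_takeFill_append (x : ℝ) (hx : 0 < x) (K Y : List ℕ) (h : x ≤ (K.map s).sum) :
    takeFill s x ((takeFill s x K).1 ++ Y) = ((takeFill s x K).1, Y) := by
  induction K generalizing x with
  | nil => simp at h; linarith
  | cons j K ih =>
    by_cases hj : x ≤ s j
    · simp [takeFill, hj]
    · have := ih (x - s j) (by linarith) (by simp at h; linarith)
      simp [takeFill, hj, this]

lemma sum_takeFill_lt (c x : ℝ) (hc : 0 ≤ c) (hx : 0 < x) (K : List ℕ) (hK : ∀ j ∈ K, s j ≤ c) :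
    ((takeFill s x K).1.map s).sum < x + c := by
  induction K generalizing x with
  | nil => simp [takeFill]; linarith
  | cons j K ih =>
    by_cases hj : x ≤ s j
    · have := hK j (by simp)
      simp [takeFill, hj]
      linarith
    · have := ih (x - s j) (by linarith) (fun k hk => hK k (by simp [hk]))
      simp [takeFill, hj]
      linarith

lemma takeFill_eq_singleton (x : ℝ) (hx : 0 < x) (K : List ℕ)
    (hK : K.Pairwise fun j j' => s j' ≤ s j) (h : 2 * x ≤ ((takeFill s x K).1.map s).sum) :
    ∃ j, (takeFill s x K).1 = [j] ∧ x ≤ s j := by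
  cases K with
  | nil => simp [takeFill] at h; linarith
  | cons j K =>
    by_cases hj : x ≤ s j
    · exact ⟨j, by simp [takeFill, hj], hj⟩
    · exfalso
      have := sum_takeFill_lt x x hx.le hx (j :: K) (s := s) (by
        rw [List.pairwise_cons] at hK
        intro k hk
        rcases List.mem_cons.1 hk with rfl | hk
        · linarith
        · linarith [hK.1 k hk])
      linarith

end TakeFill

section NfdAux

variable {d s : ℕ → ℝ}

lemma nfdAux_cons_of_le {i : ℕ} {L K : List ℕ} (h : d i ≤ (K.map s).sum) (b : ℕ) :
    nfdAux d s (i :: L) K b = if b = i then (takeFill s (d i) K).1.toFinset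
      else nfdAux d s L (takeFill s (d i) K).2 b := by
  simp [nfdAux, h]

lemma nfdAux_cons_of_not_le {i : ℕ} {L K : List ℕ} (h : ¬ d i ≤ (K.map s).sum) (b : ℕ) :
    nfdAux d s (i :: L) K b = if b = i then ∅ else nfdAux d s L K b := by
  simp [nfdAux, h]

lemma nfdAux_of_notMem {L : List ℕ} (K : List ℕ) {b : ℕ} (hb : b ∉ L) :
    nfdAux d s L K b = ∅ := by
  induction L generalizing K with
  | nil => simp [nfdAux]
  | cons i L ih =>
    simp only [List.mem_cons, not_or] at hb
    by_cases h : d i ≤ (K.map s).sum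
    · rw [nfdAux_cons_of_le h, if_neg hb.1, ih _ hb.2]
    · rw [nfdAux_cons_of_not_le h, if_neg hb.1, ih _ hb.2]

lemma mem_of_mem_nfdAux {L K : List ℕ} {b j : ℕ} (hj : j ∈ nfdAux d s L K b) : j ∈ K := by
  induction L generalizing K with
  | nil => simp [nfdAux] at hj
  | cons i L ih =>
    by_cases h : d i ≤ (K.map s).sum
    · rw [nfdAux_cons_of_le h] at hj
      rw [← takeFill_append (s := s) (d i) K, List.mem_append]
      split_ifs at hj
      · exact Or.inl (by simpa using hj)
      · exact Or.inr (ih hj)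
    · rw [nfdAux_cons_of_not_le h] at hj
      split_ifs at hj
      · simp at hj
      · exact ih hj

lemma nodup_takeFill_append {K : List ℕ} (hK : K.Nodup) (x : ℝ) :
    (takeFill s x K).1.Nodup ∧ (takeFill s x K).2.Nodup ∧
      ∀ j ∈ (takeFill s x K).1, j ∉ (takeFill s x K).2 := by
  rw [← takeFill_append (s := s) x K, List.nodup_append'] at hK
  exact ⟨hK.1, hK.2.1, fun j h h' => hK.2.2 h h'⟩

lemma disjoint_nfdAux {L K : List ℕ} (hK : K.Nodup) {b b' : ℕ} (hb : b ≠ b') :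
    Disjoint (nfdAux d s L K b) (nfdAux d s L K b') := by
  induction L generalizing K with
  | nil => simp [nfdAux]
  | cons i L ih =>
    by_cases h : d i ≤ (K.map s).sum
    · obtain ⟨-, h2, h3⟩ := nodup_takeFill_append (s := s) hK (d i)
      rw [nfdAux_cons_of_le h, nfdAux_cons_of_le h]
      split_ifs with e e'
      · exact absurd (e.trans e'.symm) hb
      · rw [Finset.disjoint_left]
        exact fun j hj hj' => h3 j (by simpa using hj) (mem_of_mem_nfdAux hj')
      · rw [Finset.disjoint_right]
        exact fun j hj hj' => h3 j (by simpa using hj) (mem_of_mem_nfdAux hj')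
      · exact ih h2
    · rw [nfdAux_cons_of_not_le h, nfdAux_cons_of_not_le h]
      split_ifs <;> simp [ih hK]

lemma nfdAux_eq_empty_or_le_sum {L K : List ℕ} (hK : K.Nodup) (b : ℕ) :
    nfdAux d s L K b = ∅ ∨ d b ≤ ∑ j ∈ nfdAux d s L K b, s j := by
  induction L generalizing K with
  | nil => simp [nfdAux]
  | cons i L ih =>
    by_cases h : d i ≤ (K.map s).sum
    · obtain ⟨h1, h2, -⟩ := nodup_takeFill_append (s := s) hK (d i)
      rw [nfdAux_cons_of_le h]
      split_ifs with e
      · subst e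
        rw [List.sum_toFinset _ h1]
        exact Or.inr (le_sum_takeFill _ _ h)
      · exact ih h2
    · rw [nfdAux_cons_of_not_le h]
      split_ifs
      · simp
      · exact ih hK

lemma nfdAux_eq_singleton {L K : List ℕ} (hK : K.Nodup)
    (hKs : K.Pairwise fun j j' => s j' ≤ s j) {b : ℕ} (hb : 0 < d b)
    (h2 : 2 * d b ≤ ∑ j ∈ nfdAux d s L K b, s j) :
    ∃ j, nfdAux d s L K b = {j} ∧ d b ≤ s j := by
  induction L generalizing K with
  | nil => simp [nfdAux] at h2; linarith
  | cons i L ih =>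
    by_cases h : d i ≤ (K.map s).sum
    · obtain ⟨n1, n2, -⟩ := nodup_takeFill_append (s := s) hK (d i)
      rw [nfdAux_cons_of_le h] at h2 ⊢
      split_ifs at h2 ⊢ with e
      · subst e
        rw [List.sum_toFinset _ n1] at h2
        obtain ⟨j, hj, hj'⟩ := takeFill_eq_singleton _ hb K hKs h2
        exact ⟨j, by simp [hj], hj'⟩
      · refine ih n2 ?_ h2
        rw [← takeFill_append (s := s) (d i) K, List.pairwise_append] at hKs
        exact hKs.2.1
    · rw [nfdAux_cons_of_not_le h] at h2 ⊢
      split_ifs at h2 ⊢ with e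
      · simp at h2; linarith
      · exact ih hK hKs h2

lemma size_le_of_mem_nfdAux {L K : List ℕ} (hL : L.Pairwise (· < ·))
    (hKs : K.Pairwise fun j j' => s j' ≤ s j) {b b' j j' : ℕ} (hb : b < b')
    (hj : j ∈ nfdAux d s L K b) (hj' : j' ∈ nfdAux d s L K b') : s j' ≤ s j := by
  induction L generalizing K with
  | nil => simp [nfdAux] at hj
  | cons i L ih =>
    rw [List.pairwise_cons] at hL
    by_cases h : d i ≤ (K.map s).sum
    · rw [nfdAux_cons_of_le h] at hj hj'
      rw [← takeFill_append (s := s) (d i) K, List.pairwise_append] at hKs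
      split_ifs at hj hj' with e e' e'
      · omega
      · exact hKs.2.2 j (by simpa using hj) j' (mem_of_mem_nfdAux hj')
      · have hbL : b ∉ L := fun hbL => by have := hL.1 b hbL; omega
        simp [nfdAux_of_notMem _ hbL] at hj
      · exact ih hL.2 hKs.2.1 hj hj'
    · rw [nfdAux_cons_of_not_le h] at hj hj'
      split_ifs at hj hj'
      all_goals first
        | exact ih hL.2 hKs hj hj'
        | simp at hj hj'

lemma sum_lt_of_nfdAux_eq_empty {L K : List ℕ} (hL : L.Pairwise (· < ·)) (hd : ∀ i ∈ L, 0 < d i)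
    {b : ℕ} (hb : b ∈ L) (hN : ∀ i ∈ L, i ≤ b → nfdAux d s L K i = ∅) :
    (K.map s).sum < d b := by
  induction L with
  | nil => simp at hb
  | cons i L ih =>
    rw [List.pairwise_cons] at hL
    by_cases h : d i ≤ (K.map s).sum
    · exfalso
      have hib : i ≤ b := by
        rcases List.mem_cons.1 hb with rfl | hb
        · exact le_rfl
        · exact (hL.1 b hb).le
      have h0 := hN i (by simp) hib
      rw [nfdAux_cons_of_le h, if_pos rfl, List.toFinset_eq_empty_iff] at h0
      have h1 := le_sum_takeFill _ _ h
      have h2 := hd i (by simp)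
      rw [h0] at h1
      simp at h1
      linarith
    · rcases List.mem_cons.1 hb with rfl | hb
      · exact not_le.1 h
      · refine ih hL.2 (fun k hk => hd k (by simp [hk])) hb fun k hk hkb => ?_
        have := hN k (by simp [hk]) hkb
        rwa [nfdAux_cons_of_not_le h, if_neg (by have := hL.1 k hk; omega)] at this

/-- Deleting covered bins together with the items NFD assigns to them does not change
what NFD assigns to the other bins. -/
lemma nfdAux_filter {L K : List ℕ} (hL : L.Nodup) (hK : K.Nodup) (hd : ∀ i ∈ L, 0 < d i)
    (hs : ∀ j ∈ K, 0 ≤ s j) (R : Finset ℕ)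
    (hR : ∀ i ∈ R, i ∈ L → (nfdAux d s L K i).Nonempty) {b : ℕ} (hb : b ∉ R) :
    nfdAux d s (L.filter (· ∉ R)) (K.filter (· ∉ R.biUnion (nfdAux d s L K))) b =
      nfdAux d s L K b := by
  induction L generalizing K with
  | nil => simp [nfdAux]
  | cons i L ih =>
    rw [List.nodup_cons] at hL
    have hd' : ∀ i ∈ L, 0 < d i := fun k hk => hd k (by simp [hk])
    by_cases h : d i ≤ (K.map s).sum
    · obtain ⟨n1, n2, n3⟩ := nodup_takeFill_append (s := s) hK (d i)
      have hQ : ∀ j ∈ (takeFill s (d i) K).2, j ∈ K := fun j hj => by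
        rw [← takeFill_append (s := s) (d i) K]; simp [hj]
      have IH := ih hL.2 n2 hd' (fun j hj => hs j (hQ j hj)) fun r hr hrL => by
        have := hR r hr (by simp [hrL])
        rwa [nfdAux_cons_of_le h, if_neg (by rintro rfl; exact hL.1 hrL)] at this
      have hX : (takeFill s (d i) K).2.filter (· ∉ R.biUnion (nfdAux d s (i :: L) K)) =
          (takeFill s (d i) K).2.filter
            (· ∉ R.biUnion (nfdAux d s L (takeFill s (d i) K).2)) := by
        refine List.filter_congr fun j hj => ?_
        congr 1
        rw [eq_iff_iff, not_iff_not]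
        simp only [Finset.mem_biUnion]
        refine exists_congr fun r => and_congr_right fun hr => ?_
        rw [nfdAux_cons_of_le h]
        split_ifs with e
        · subst e
          rw [nfdAux_of_notMem _ hL.1]
          simp only [List.mem_toFinset, Finset.notMem_empty, iff_false]
          exact fun hj' => n3 j hj' hj
        · rfl
      by_cases hi : i ∈ R
      · have h1 : (takeFill s (d i) K).1.filter
            (· ∉ R.biUnion (nfdAux d s (i :: L) K)) = [] := by
          rw [List.filter_eq_nil_iff]
          intro j hj
          have : j ∈ R.biUnion (nfdAux d s (i :: L) K) :=
            Finset.mem_biUnion.2 ⟨i, hi, by rw [nfdAux_cons_of_le h, if_pos rfl]; simpa using hj⟩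
          simpa using this
        have h2 : K.filter (· ∉ R.biUnion (nfdAux d s (i :: L) K)) =
            (takeFill s (d i) K).2.filter
              (· ∉ R.biUnion (nfdAux d s L (takeFill s (d i) K).2)) := by
          conv_lhs => enter [2]; rw [← takeFill_append (s := s) (d i) K]
          rw [List.filter_append, h1, List.nil_append, hX]
        rw [h2, List.filter_cons_of_neg (by simpa using hi), IH, nfdAux_cons_of_le h,
          if_neg (by rintro rfl; exact hb hi)]
      · have h1 : (takeFill s (d i) K).1.filter
            (· ∉ R.biUnion (nfdAux d s (i :: L) K)) = (takeFill s (d i) K).1 := by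
          rw [List.filter_eq_self]
          intro j hj
          have : j ∉ R.biUnion (nfdAux d s (i :: L) K) := by
            rw [Finset.mem_biUnion]
            rintro ⟨r, hr, hjr⟩
            rw [nfdAux_cons_of_le h, if_neg (by rintro rfl; exact hi hr)] at hjr
            exact n3 j hj (mem_of_mem_nfdAux hjr)
          simpa using this
        have h2 : K.filter (· ∉ R.biUnion (nfdAux d s (i :: L) K)) =
            (takeFill s (d i) K).1 ++ (takeFill s (d i) K).2.filter
              (· ∉ R.biUnion (nfdAux d s L (takeFill s (d i) K).2)) := by
          conv_lhs => enter [2]; rw [← takeFill_append (s := s) (d i) K]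
          rw [List.filter_append, h1, hX]
        have h3 := le_sum_takeFill _ _ h
        have h4 : 0 ≤ (((takeFill s (d i) K).2.filter
              (· ∉ R.biUnion (nfdAux d s L (takeFill s (d i) K).2))).map s).sum := by
          refine List.sum_nonneg fun x hx => ?_
          obtain ⟨j, hj, rfl⟩ := List.mem_map.1 hx
          exact hs j (hQ j (List.mem_of_mem_filter hj))
        rw [h2, List.filter_cons_of_pos (by simpa using hi), nfdAux_cons_of_le h,
          nfdAux_cons_of_le (by rw [List.map_append, List.sum_append]; linarith),
          takeFill_takeFill_append _ (hd i (by simp)) _ _ h, IH]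
    · have hi : i ∉ R := fun hi => by
        have := hR i hi (by simp)
        simp [nfdAux_cons_of_not_le h] at this
      have IH := ih hL.2 hK hd' hs fun r hr hrL => by
        have := hR r hr (by simp [hrL])
        rwa [nfdAux_cons_of_not_le h, if_neg (by rintro rfl; exact hL.1 hrL)] at this
      have hX : R.biUnion (nfdAux d s (i :: L) K) = R.biUnion (nfdAux d s L K) :=
        Finset.biUnion_congr rfl fun r hr => by
          rw [nfdAux_cons_of_not_le h, if_neg (by rintro rfl; exact hi hr)]
      have h1 : ((K.filter (· ∉ R.biUnion (nfdAux d s L K))).map s).sum ≤ (K.map s).sum :=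
        (List.filter_sublist.map s).sum_le_sum (by simpa using hs)
      rw [hX, List.filter_cons_of_pos (by simpa using hi), nfdAux_cons_of_not_le h,
        nfdAux_cons_of_not_le (by linarith), IH]

end NfdAux

section Opt

variable {d s : ℕ → ℝ} {B T : Finset ℕ}

lemma profit_le_OPT (hd : ∀ i ∈ B, 0 ≤ d i) {S : ℕ → Finset ℕ} (hS : IsSolution T S) :
    profit d d s B S ≤ OPT d d s B T := by
  refine le_csSup ⟨∑ i ∈ B, d i, ?_⟩ ⟨S, hS, rfl⟩
  rintro _ ⟨S', -, rfl⟩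
  refine Finset.sum_le_sum fun i hi => ?_
  split_ifs
  · exact le_rfl
  · exact hd i hi

lemma OPT_le {c : ℝ} (h : ∀ S, IsSolution T S → profit d d s B S ≤ c) : OPT d d s B T ≤ c := by
  refine csSup_le ⟨_, fun _ => ∅, ⟨by simp, fun _ _ _ => by simp⟩, rfl⟩ ?_
  rintro _ ⟨S, hS, rfl⟩
  exact h S hS

/-- A bin together with one item can be removed at the cost of the demand of the bin,
if no larger bin uses the item. -/
lemma exists_profit_le_of_notMem_lt (hd : ∀ i ∈ B, 0 ≤ d i)
    (hdm : ∀ i ∈ B, ∀ i' ∈ B, i ≤ i' → d i' ≤ d i)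
    {i j : ℕ} (hi : i ∈ B) {S : ℕ → Finset ℕ} (hS : IsSolution T S)
    (hj : ∀ b ∈ B, b < i → j ∉ S b) :
    ∃ S', IsSolution (T \ {j}) S' ∧ profit d d s B S ≤ profit d d s (B \ {i}) S' + d i := by
  have hsplit : profit d d s B S = profit d d s (B \ {i}) S +
      if d i ≤ ∑ k ∈ S i, s k then d i else 0 := by
    unfold profit
    rw [Finset.sdiff_singleton_eq_erase, Finset.sum_erase_add _ _ hi]
  by_cases hb : ∃ b ∈ B, i < b ∧ j ∈ S b
  · obtain ⟨b, hbB, hib, hjb⟩ := hb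
    have hu : ∀ c, c ≠ b → j ∉ S c := fun c hc hjc =>
      Finset.disjoint_left.1 (hS.2 hc) hjc hjb
    refine ⟨fun c => if c = b then S i else if c = i then ∅ else S c \ {j}, ⟨?_, ?_⟩, ?_⟩
    · intro c
      have := hS.1
      dsimp only
      split_ifs with h1 h2
      · intro k hk
        simp only [Finset.mem_sdiff, Finset.mem_singleton]
        exact ⟨hS.1 i hk, by rintro rfl; exact hu i hib.ne hk⟩
      · simp
      · exact Finset.sdiff_subset_sdiff (hS.1 c) subset_rfl
    · intro c c' hcc
      dsimp only
      split_ifs with h1 h2 h3 h4 h5 h6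
      · omega
      · simp
      · exact (hS.2 (Ne.symm h3)).mono_right Finset.sdiff_subset
      · simp
      · simp
      · simp
      · exact (hS.2 h4).mono_left Finset.sdiff_subset
      · simp
      · exact (hS.2 hcc).mono Finset.sdiff_subset Finset.sdiff_subset
    · have hbm : b ∈ B \ {i} := by simp [hbB, hib.ne']
      rw [hsplit]
      unfold profit
      rw [← Finset.add_sum_erase _ _ hbm, ← Finset.add_sum_erase (B \ {i}) _ hbm]
      have hrest : ∑ c ∈ (B \ {i}).erase b, (if d c ≤ ∑ k ∈ S c, s k then d c else 0) =
          ∑ c ∈ (B \ {i}).erase b, (if d c ≤ ∑ k ∈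
            (if c = b then S i else if c = i then ∅ else S c \ {j}), s k then d c else 0) := by
        refine Finset.sum_congr rfl fun c hc => ?_
        simp only [Finset.mem_erase, Finset.mem_sdiff, Finset.mem_singleton] at hc
        rw [if_neg hc.1, if_neg hc.2.2, Finset.sdiff_singleton_eq_erase, Finset.erase_eq_of_notMem (hu c hc.1)]
      rw [hrest]
      simp only [if_true]
      have h1 := hdm i hi b hbB hib.le
      have h2 := hd b hbB
      have h3 := hd i hi
      split_ifs <;> linarith
  · push Not at hb
    refine ⟨fun c => S c \ {j}, ⟨fun c => Finset.sdiff_subset_sdiff (hS.1 c) subset_rfl,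
      fun c c' hcc => (hS.2 hcc).mono Finset.sdiff_subset Finset.sdiff_subset⟩, ?_⟩
    have : profit d d s (B \ {i}) S = profit d d s (B \ {i}) fun c => S c \ {j} := by
      refine Finset.sum_congr rfl fun c hc => ?_
      simp only [Finset.mem_sdiff, Finset.mem_singleton] at hc
      have : j ∉ S c := by
        rcases lt_or_gt_of_ne hc.2 with h | h
        · exact hj c hc.1 h
        · exact hb c hc.1 h
      simp only [Finset.sdiff_singleton_eq_erase, Finset.erase_eq_of_notMem this]
    rw [hsplit, this]
    have := hd i hi
    split_ifs <;> linarith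

/-- The item `j` of a solution may be exchanged for a larger item that is not used
by the bins before `i`, if `j` covers `i`. -/
lemma exists_swap (hs : ∀ j ∈ T, 0 ≤ s j)
    (hd : ∀ i ∈ B, 0 ≤ d i) (hdm : ∀ i ∈ B, ∀ i' ∈ B, i ≤ i' → d i' ≤ d i)
    {i j j' b : ℕ} (hi : i ∈ B) (hjT : j ∈ T) (hj'T : j' ∈ T) (hjj : s j ≤ s j')
    (hij : d i ≤ s j) {S : ℕ → Finset ℕ} (hS : IsSolution T S) (hbi : b < i)
    (hjb : j ∈ S b) (hj' : ∀ c ∈ B, c < i → j' ∉ S c) :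
    ∃ S', IsSolution T S' ∧ profit d d s B S ≤ profit d d s B S' ∧
      ∀ c ∈ B, c < i → j ∉ S' c := by
  have hmem : ∀ c k, k ∈ (S c).map (Equiv.swap j j').toEmbedding ↔ Equiv.swap j j' k ∈ S c := by
    intro c k
    rw [Finset.mem_map_equiv, Equiv.symm_swap]
  refine ⟨fun c => (S c).map (Equiv.swap j j').toEmbedding, ⟨fun c k hk => ?_, fun c c' hcc => ?_⟩,
    Finset.sum_le_sum fun c hc => ?_, fun c hc hci hjc => ?_⟩
  · rw [hmem] at hk
    have := hS.1 c hk
    rw [Equiv.swap_apply_def] at this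
    split_ifs at this with h1 h2
    · rwa [h1]
    · rwa [h2]
    · exact this
  · exact (Finset.disjoint_map _).2 (hS.2 hcc)
  · have key : d c ≤ ∑ k ∈ S c, s k →
        d c ≤ ∑ k ∈ (S c).map (Equiv.swap j j').toEmbedding, s k := by
      intro h
      by_cases hci : c < i
      · refine h.trans ?_
        rw [Finset.sum_map]
        refine Finset.sum_le_sum fun k hk => ?_
        simp only [Equiv.coe_toEmbedding, Equiv.swap_apply_def]
        split_ifs with h1 h2
        · rwa [h1]
        · exact absurd (h2 ▸ hk) (hj' c hc hci)
        · exact le_rfl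
      · have hjc : j ∉ S c := Finset.disjoint_left.1 (hS.2 (by omega)) hjb
        by_cases hj'c : j' ∈ S c
        · refine ((hdm i hi c hc (by omega)).trans hij).trans ?_
          refine Finset.single_le_sum (f := s) (fun k hk => ?_) ?_
          · rw [hmem] at hk
            have := hS.1 c hk
            rw [Equiv.swap_apply_def] at this
            split_ifs at this with h1 h2
            · exact hs k (h1 ▸ hjT)
            · exact hs k (h2 ▸ hj'T)
            · exact hs k this
          · rw [hmem]; simpa using hj'c
        · refine h.trans (le_of_eq ?_)
          rw [Finset.sum_map]
          refine Finset.sum_congr rfl fun k hk => ?_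
          simp only [Equiv.coe_toEmbedding]
          rw [Equiv.swap_apply_of_ne_of_ne]
          · rintro rfl; exact hjc hk
          · rintro rfl; exact hj'c hk
    have := hd c hc
    by_cases h : d c ≤ ∑ k ∈ S c, s k
    · rw [if_pos h, if_pos (key h)]
    · rw [if_neg h]
      split_ifs <;> linarith
  · rw [hmem] at hjc
    exact hj' c hc hci (by simpa using hjc)

/-- A bin `i` covered by a single item `j` can be removed together with this item at the cost
of the demand of `i`, if all coverable larger bins are covered by `N` with items not smaller
than `j`. -/
lemma OPT_le_OPT_sdiff_add (hs : ∀ j ∈ T, 0 ≤ s j)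
    (hd : ∀ i ∈ B, 0 ≤ d i) (hdm : ∀ i ∈ B, ∀ i' ∈ B, i ≤ i' → d i' ≤ d i)
    {N : ℕ → Finset ℕ} (hNT : ∀ b ∈ B, N b ⊆ T)
    (hND : Pairwise fun i i' => Disjoint (N i) (N i'))
    {i j : ℕ} (hi : i ∈ B) (hNi : N i = {j}) (hij : d i ≤ s j)
    (hcov : ∀ b ∈ B, b < i → ∑ k ∈ T, s k < d b ∨ d b ≤ ∑ k ∈ N b, s k)
    (hbig : ∀ b ∈ B, b < i → ∀ k ∈ N b, s j ≤ s k) :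
    OPT d d s B T ≤ OPT d d s (B \ {i}) (T \ {j}) + d i := by
  have hjT : j ∈ T := hNT i hi (by simp [hNi])
  refine OPT_le fun S hS => ?_
  suffices ∃ S', IsSolution (T \ {j}) S' ∧
      profit d d s B S ≤ profit d d s (B \ {i}) S' + d i by
    obtain ⟨S', hS', h⟩ := this
    have := profit_le_OPT (s := s) (d := d) (B := B \ {i})
      (fun k hk => hd k (Finset.sdiff_subset hk)) hS'
    linarith
  by_cases hj : ∀ b ∈ B, b < i → j ∉ S b
  · exact exists_profit_le_of_notMem_lt hd hdm hi hS hj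
  push Not at hj
  obtain ⟨b, hbB, hbi, hjb⟩ := hj
  by_cases hP : ∃ b' ∈ B, b' < i ∧ ∃ j' ∈ N b', ∀ c ∈ B, c < i → j' ∉ S c
  · obtain ⟨b', hb'B, hb'i, j', hj', hun⟩ := hP
    obtain ⟨S', hS', hle, hfree⟩ := exists_swap hs hd hdm hi hjT (hNT b' hb'B hj')
      (hbig b' hb'B hb'i j' hj') hij hS hbi hjb hun
    obtain ⟨S'', hS'', hle'⟩ := exists_profit_le_of_notMem_lt (s := s) hd hdm hi hS' hfree
    exact ⟨S'', hS'', hle.trans hle'⟩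
  · push Not at hP
    have hcross : ∀ c ∈ B, c < i → ∀ c', i < c' → Disjoint (N c) (S c' \ {j}) := by
      intro c hc hci c' hc'
      rw [Finset.disjoint_left]
      intro k hk hk'
      obtain ⟨e, -, hei, hke⟩ := hP c hc hci k hk
      exact Finset.disjoint_left.1 (hS.2 (show e ≠ c' by omega)) hke (Finset.sdiff_subset hk')
    refine ⟨fun c => if c < i then (if c ∈ B then N c else ∅) else if c = i then ∅
      else S c \ {j}, ⟨fun c => ?_, fun c c' hcc => ?_⟩, ?_⟩
    · dsimp only
      split_ifs with h1 h2 h3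
      · intro k hk
        simp only [Finset.mem_sdiff, Finset.mem_singleton]
        refine ⟨hNT c h2 hk, ?_⟩
        rintro rfl
        exact Finset.disjoint_left.1 (hND h1.ne) hk (by simp [hNi])
      · simp
      · simp
      · exact Finset.sdiff_subset_sdiff (hS.1 c) subset_rfl
    · dsimp only
      split_ifs
      any_goals simp only [Finset.disjoint_empty_left, Finset.disjoint_empty_right]
      · exact hND hcc
      · exact hcross c (by assumption) (by assumption) c' (by omega)
      · exact (hcross c' (by assumption) (by assumption) c (by omega)).symm
      · exact (hS.2 hcc).mono Finset.sdiff_subset Finset.sdiff_subset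
    · have h1 : profit d d s B S = profit d d s (B \ {i}) S +
          if d i ≤ ∑ k ∈ S i, s k then d i else 0 := by
        unfold profit
        rw [Finset.sdiff_singleton_eq_erase, Finset.sum_erase_add _ _ hi]
      rw [h1]
      refine add_le_add (Finset.sum_le_sum fun c hc => ?_) ?_
      · simp only [Finset.mem_sdiff, Finset.mem_singleton] at hc
        obtain ⟨hcB, hci⟩ := hc
        have hdc := hd c hcB
        rcases lt_or_gt_of_ne hci with hlt | hgt
        · simp only [if_pos hlt, if_pos hcB]
          rcases hcov c hcB hlt with h | h
          · rw [if_neg]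
            · split_ifs <;> linarith
            · have := Finset.sum_le_sum_of_subset_of_nonneg (f := s) (hS.1 c)
                fun k hk _ => hs k hk
              linarith
          · rw [if_pos h]
            split_ifs <;> linarith
        · simp only [if_neg hgt.not_gt, if_neg hci, Finset.sdiff_singleton_eq_erase,
            Finset.erase_eq_of_notMem (Finset.disjoint_left.1 (hS.2 (show b ≠ c by omega)) hjb), le_refl]
      · have := hd i hi
        split_ifs <;> linarith

/-- Iterated version of `OPT_le_OPT_sdiff_add` for a set `R` of bins covered by single items. -/
lemma OPT_le_OPT_sdiff_biUnion_add {N : ℕ → Finset ℕ}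
    (hND : Pairwise fun i i' => Disjoint (N i) (N i'))
    (R : Finset ℕ) (hs : ∀ j ∈ T, 0 ≤ s j)
    (hd : ∀ i ∈ B, 0 ≤ d i) (hdm : ∀ i ∈ B, ∀ i' ∈ B, i ≤ i' → d i' ≤ d i)
    (hNT : ∀ b ∈ B, N b ⊆ T) (hRB : R ⊆ B)
    (hR : ∀ i ∈ R, ∃ j, N i = {j} ∧ d i ≤ s j)
    (hcov : ∀ i ∈ R, ∀ b ∈ B, b < i → ∑ k ∈ T, s k < d b ∨ d b ≤ ∑ k ∈ N b, s k)
    (hbig : ∀ i ∈ R, ∀ b ∈ B, b < i → ∀ k ∈ N b, ∀ j ∈ N i, s j ≤ s k) :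
    OPT d d s B T ≤ OPT d d s (B \ R) (T \ R.biUnion N) + ∑ i ∈ R, d i := by
  induction R using Finset.induction_on generalizing B T with
  | empty => simp
  | insert i R hiR ih =>
    obtain ⟨j, hj, hij⟩ := hR i (by simp)
    have hi : i ∈ B := hRB (by simp)
    have h1 := OPT_le_OPT_sdiff_add hs hd hdm hNT hND hi hj hij (hcov i (by simp))
      (fun b hb hbi k hk => hbig i (by simp) b hb hbi k hk j (by simp [hj]))
    have hsub : ∀ b ∈ B \ {i}, b ∈ B := fun b hb => Finset.sdiff_subset hb
    have h2 := ih (B := B \ {i}) (T := T \ {j}) (fun k hk => hs k (Finset.sdiff_subset hk))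
      (fun k hk => hd k (hsub k hk)) (fun k hk k' hk' => hdm k (hsub k hk) k' (hsub k' hk'))
      (fun b hb k hk => by
        simp only [Finset.mem_sdiff, Finset.mem_singleton] at hb ⊢
        refine ⟨hNT b hb.1 hk, ?_⟩
        rintro rfl
        exact Finset.disjoint_left.1 (hND hb.2) hk (by simp [hj]))
      (fun r hr => by
        simp only [Finset.mem_sdiff, Finset.mem_singleton]
        exact ⟨hRB (by simp [hr]), by rintro rfl; exact hiR hr⟩)
      (fun r hr => hR r (by simp [hr]))
      (fun r hr b hb hbr => (hcov r (by simp [hr]) b (hsub b hb) hbr).imp_left fun h =>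
        lt_of_le_of_lt (Finset.sum_le_sum_of_subset_of_nonneg Finset.sdiff_subset
          fun k hk _ => hs k hk) h)
      (fun r hr b hb => hbig r (by simp [hr]) b (hsub b hb))
    have e1 : B \ insert i R = (B \ {i}) \ R := by
      rw [sdiff_sdiff_left, Finset.insert_eq, Finset.sup_eq_union]
    have e2 : T \ (insert i R).biUnion N = (T \ {j}) \ R.biUnion N := by
      rw [sdiff_sdiff_left, Finset.biUnion_insert, hj, Finset.sup_eq_union]
    rw [e1, e2, Finset.sum_insert hiR]
    linarith

end Opt

section Nfd

variable {d s : ℕ → ℝ} {B T : Finset ℕ}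

lemma isSolution_nfdSol : IsSolution T (nfdSol d s B T) :=
  ⟨fun _ _ hj => (Finset.mem_sort _).1 (mem_of_mem_nfdAux hj),
    fun _ _ h => disjoint_nfdAux (Finset.sort_nodup _ _) h⟩

lemma sort_sdiff (A X : Finset ℕ) :
    (A \ X).sort (· ≤ ·) = (A.sort (· ≤ ·)).filter (· ∉ X) := by
  refine List.Perm.eq_of_pairwise' (r := (· ≤ ·)) (Finset.pairwise_sort _ _)
    ((Finset.pairwise_sort _ _).filter _) ?_
  rw [List.perm_ext_iff_of_nodup (Finset.sort_nodup _ _) ((Finset.sort_nodup _ _).filter _)]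
  simp

lemma nfdSol_sdiff (hd : ∀ i ∈ B, 0 < d i) (hs : ∀ j ∈ T, 0 ≤ s j) {R : Finset ℕ}
    (hR : ∀ i ∈ R, (nfdSol d s B T i).Nonempty) {b : ℕ} (hb : b ∉ R) :
    nfdSol d s (B \ R) (T \ R.biUnion (nfdSol d s B T)) b = nfdSol d s B T b := by
  have := nfdAux_filter (d := d) (s := s) (Finset.sort_nodup B (· ≤ ·))
    (Finset.sort_nodup T (· ≤ ·)) (by simpa using hd) (by simpa using hs) R
    (fun i hi _ => hR i hi) hb
  rw [nfdSol, sort_sdiff, sort_sdiff]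
  exact this

lemma NFD_sdiff_add (hd : ∀ i ∈ B, 0 < d i) (hs : ∀ j ∈ T, 0 ≤ s j) {R : Finset ℕ} (hRB : R ⊆ B)
    (hR : ∀ i ∈ R, (nfdSol d s B T i).Nonempty) :
    NFD d s (B \ R) (T \ R.biUnion (nfdSol d s B T)) + ∑ i ∈ R, d i = NFD d s B T := by
  unfold NFD profit
  rw [← Finset.sum_sdiff hRB]
  congr 1
  · refine Finset.sum_congr rfl fun b hb => ?_
    rw [nfdSol_sdiff hd hs hR (Finset.mem_sdiff.1 hb).2]
  · refine Finset.sum_congr rfl fun i hi => ?_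
    rw [if_pos]
    exact (nfdAux_eq_empty_or_le_sum (Finset.sort_nodup _ _) i).resolve_left (hR i hi).ne_empty

lemma NFD_nonneg (hd : ∀ i ∈ B, 0 ≤ d i) : 0 ≤ NFD d s B T :=
  Finset.sum_nonneg fun i hi => by
    split_ifs
    · exact hd i hi
    · exact le_rfl

lemma pairwise_sort_size (hsm : ∀ j ∈ T, ∀ j' ∈ T, j ≤ j' → s j' ≤ s j) :
    (T.sort (· ≤ ·)).Pairwise fun j j' => s j' ≤ s j :=
  (Finset.pairwise_sort T (· ≤ ·)).imp_of_mem fun {j j'} hj hj' h =>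
    hsm j ((Finset.mem_sort _).1 hj) j' ((Finset.mem_sort _).1 hj') h

lemma sum_lt_of_nfdSol_eq_empty (hd : ∀ i ∈ B, 0 < d i) {b : ℕ} (hb : b ∈ B)
    (hN : ∀ i ≤ b, nfdSol d s B T i = ∅) : ∑ j ∈ T, s j < d b := by
  have := sum_lt_of_nfdAux_eq_empty (d := d) (s := s) (K := T.sort (· ≤ ·))
    (Finset.sortedLT_sort B).pairwise (by simpa using hd) ((Finset.mem_sort (· ≤ ·)).2 hb)
    (fun i _ hi => hN i hi)
  rwa [← List.sum_toFinset _ (Finset.sort_nodup _ _), Finset.sort_toFinset] at this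

end Nfd

/- STATEMENT 10 -/
theorem stmt10 (m n : ℕ) (d s : ℕ → ℝ)
    (hd : ∀ i < m, 0 < d i) (hdm : ∀ i i', i ≤ i' → i' < m → d i' ≤ d i)
    (hs : ∀ j < n, 0 < s j) (hsm : ∀ j j', j ≤ j' → j' < n → s j' ≤ s j)
    (istar : ℕ) (h1 : istar + 1 < m)
    (hpos : 0 < nfdU d s (Finset.range m) (Finset.range n) istar)
    (hzero : nfdU d s (Finset.range m) (Finset.range n) (istar + 1) = 0)
    (hmin : ∀ i < istar, ¬(0 < nfdU d s (Finset.range m) (Finset.range n) i ∧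
        nfdU d s (Finset.range m) (Finset.range n) (i + 1) = 0))
    (hNFD' : 0 < NFD d s
        (Finset.range m \ ((Finset.range (istar + 1)).filter fun i =>
          2 * d i ≤ nfdU d s (Finset.range m) (Finset.range n) i))
        (Finset.range n \ (((Finset.range (istar + 1)).filter fun i =>
          2 * d i ≤ nfdU d s (Finset.range m) (Finset.range n) i).biUnion
            (nfdSol d s (Finset.range m) (Finset.range n))))) :
    OPT d d s (Finset.range m) (Finset.range n) *
        NFD d s
          (Finset.range m \ ((Finset.range (istar + 1)).filter fun i =>
            2 * d i ≤ nfdU d s (Finset.range m) (Finset.range n) i))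
          (Finset.range n \ (((Finset.range (istar + 1)).filter fun i =>
            2 * d i ≤ nfdU d s (Finset.range m) (Finset.range n) i).biUnion
              (nfdSol d s (Finset.range m) (Finset.range n)))) ≤
      OPT d d s
          (Finset.range m \ ((Finset.range (istar + 1)).filter fun i =>
            2 * d i ≤ nfdU d s (Finset.range m) (Finset.range n) i))
          (Finset.range n \ (((Finset.range (istar + 1)).filter fun i =>
            2 * d i ≤ nfdU d s (Finset.range m) (Finset.range n) i).biUnion
              (nfdSol d s (Finset.range m) (Finset.range n)))) *
        NFD d s (Finset.range m) (Finset.range n) := by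
  have hB : ∀ i ∈ Finset.range m, 0 < d i := fun i hi => hd i (Finset.mem_range.1 hi)
  have hT : ∀ j ∈ Finset.range n, 0 ≤ s j := fun j hj => (hs j (Finset.mem_range.1 hj)).le
  have hTs := pairwise_sort_size (T := Finset.range n) (s := s) fun j _ j' hj' h =>
    hsm j j' h (Finset.mem_range.1 hj')
  set R := (Finset.range (istar + 1)).filter fun i =>
    2 * d i ≤ nfdU d s (Finset.range m) (Finset.range n) i with hRdef
  have hRmem : ∀ i ∈ R, i ≤ istar ∧ 2 * d i ≤ nfdU d s (Finset.range m) (Finset.range n) i := by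
    intro i hi
    simp only [hRdef, Finset.mem_filter, Finset.mem_range] at hi
    exact ⟨by omega, hi.2⟩
  have hRB : R ⊆ Finset.range m := fun i hi => by
    have := (hRmem i hi).1
    simp only [Finset.mem_range]
    omega
  have hRsingle : ∀ i ∈ R, ∃ j, nfdSol d s (Finset.range m) (Finset.range n) i = {j} ∧
      d i ≤ s j := fun i hi =>
    nfdAux_eq_singleton (Finset.sort_nodup _ _) hTs (hB i (hRB hi)) (hRmem i hi).2
  have hpos_iff : ∀ i, 0 < nfdU d s (Finset.range m) (Finset.range n) i ↔
      nfdSol d s (Finset.range m) (Finset.range n) i ≠ ∅ := by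
    intro i
    constructor
    · intro h h0
      simp [nfdU, h0] at h
    · intro h
      exact Finset.sum_pos (fun j hj => hs j (Finset.mem_range.1 (isSolution_nfdSol.1 i hj)))
        (Finset.nonempty_iff_ne_empty.2 h)
  have hstay : ∀ i b, i ≤ b → b ≤ istar →
      nfdSol d s (Finset.range m) (Finset.range n) i ≠ ∅ →
      nfdSol d s (Finset.range m) (Finset.range n) b ≠ ∅ := by
    intro i b hib hb h
    induction b, hib using Nat.le_induction with
    | base => exact h
    | succ b hib ih =>
      intro h0
      exact hmin b (by omega) ⟨(hpos_iff b).2 (ih (by omega)), by simp [nfdU, h0]⟩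
  have hOPT := OPT_le_OPT_sdiff_biUnion_add (d := d) (s := s) (B := Finset.range m)
    (T := Finset.range n) (N := nfdSol d s (Finset.range m) (Finset.range n))
    isSolution_nfdSol.2 R hT (fun i hi => (hB i hi).le)
    (fun i _ i' hi' h => hdm i i' h (Finset.mem_range.1 hi'))
    (fun b _ => isSolution_nfdSol.1 b) hRB hRsingle
    (fun i hi b hb hbi => by
      rcases nfdAux_eq_empty_or_le_sum (d := d) (s := s)
        (L := (Finset.range m).sort (· ≤ ·)) (Finset.sort_nodup (Finset.range n) (· ≤ ·)) b
        with h | h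
      · refine Or.inl (sum_lt_of_nfdSol_eq_empty hB hb fun k hk => ?_)
        by_contra hne
        exact hstay k b hk (by have := (hRmem i hi).1; omega) hne h
      · exact Or.inr h)
    (fun i _ b _ hbi k hk j hj =>
      size_le_of_mem_nfdAux (Finset.sortedLT_sort _).pairwise hTs hbi hk hj)
  have hNFD := NFD_sdiff_add (d := d) (s := s) hB hT hRB fun i hi => by
    obtain ⟨j, hj, -⟩ := hRsingle i hi
    simp [hj]
  have hle : NFD d s (Finset.range m \ R)
      (Finset.range n \ R.biUnion (nfdSol d s (Finset.range m) (Finset.range n))) ≤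
      OPT d d s (Finset.range m \ R)
      (Finset.range n \ R.biUnion (nfdSol d s (Finset.range m) (Finset.range n))) :=
    profit_le_OPT (fun i hi => (hB i (Finset.sdiff_subset hi)).le) isSolution_nfdSol
  have hD : 0 ≤ ∑ i ∈ R, d i := Finset.sum_nonneg fun i hi => (hB i (hRB hi)).le
  rw [← hNFD]
  nlinarith [mul_le_mul_of_nonneg_right hOPT hNFD'.le, mul_le_mul_of_nonneg_left hle hD]

end BinCov
end
end
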